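/- For each N let Q^N be an exchangeable probability measure on 𝒳^N, and suppose the empirical measure map r^N under Q^N satisfies a locally uniform large deviation principle on 𝒫(𝒳) with lower semicontinuous rate function J : 𝒫(𝒳) → [0,∞] satisfying J(q) < ∞ for all q ∈ 𝒫(𝒳). Then for every q ∈ 𝒫(𝒳), lim_{N→∞} (1/N) R( ⊗^N q ‖ Q^N ) = J(q). -/

import Mathlib

open scoped BigOperators
open Filter

/-- Empirical measure of a configuration `x ∈ 𝒳^N`. -/
noncomputable def empMeasure {d N : ℕ} (x : Fin N → Fin d) : Fin d → ℝ :=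
  fun y => (1 / (N : ℝ)) * ∑ i, if x i = y then 1 else 0

/-- `q ∈ 𝒫_N(𝒳)`: a probability vector whose entries are multiples of `1/N`. -/
def IsLatticeProb {d : ℕ} (N : ℕ) (q : Fin d → ℝ) : Prop :=
  q ∈ stdSimplex ℝ (Fin d) ∧ ∀ x, ∃ k : ℕ, (N : ℝ) * q x = k

/-- A probability vector `Q` on `𝒳^N` is exchangeable if it is invariant under
every permutation of the `N` coordinates. -/
def Exchangeable {d N : ℕ} (Q : (Fin N → Fin d) → ℝ) : Prop :=
  ∀ σ : Equiv.Perm (Fin N), ∀ x : Fin N → Fin d, Q (x ∘ σ) = Q x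

/- The mass `Q^N({y : r^N(y) = r})` assigned by `Q` to the empirical-measure
class of `r`. -/
open Classical in
noncomputable def classMass {d N : ℕ} (Q : (Fin N → Fin d) → ℝ)
    (r : Fin d → ℝ) : ℝ :=
  ∑ y ∈ Finset.univ.filter (fun y : Fin N → Fin d => empMeasure y = r), Q y

/-- The empirical measures under `Q^N` satisfy a locally uniform large
deviation principle with rate function `J`: for every `q ∈ 𝒫(𝒳)` and every
sequence `q_N ∈ 𝒫_N(𝒳)` with `q_N → q`,
`(1/N) log Q^N({y : r^N(y) = q_N}) → −J(q)`. -/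
def LocallyUniformLDP {d : ℕ} (Q : ∀ N : ℕ, (Fin N → Fin d) → ℝ)
    (J : (Fin d → ℝ) → ℝ) : Prop :=
  ∀ q ∈ stdSimplex ℝ (Fin d), ∀ qseq : (N : ℕ) → Fin d → ℝ,
    (∀ N, IsLatticeProb N (qseq N)) → Tendsto qseq atTop (nhds q) →
    Tendsto (fun N : ℕ => (1 / (N : ℝ)) * Real.log (classMass (Q N) (qseq N)))
      atTop (nhds (-J q))

/-- The product measure `⊗^N q` on `𝒳^N`. -/
noncomputable def productMeasure {d N : ℕ} (q : Fin d → ℝ)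
    (x : Fin N → Fin d) : ℝ :=
  ∏ i, q (x i)

/-- Relative entropy of probability vectors on `𝒳^N` (convention `0 log 0 = 0`). -/
noncomputable def relEntN {d N : ℕ} (P Q : (Fin N → Fin d) → ℝ) : ℝ :=
  ∑ x : Fin N → Fin d, P x * Real.log (P x / Q x)

lemma aux_perm {d N : ℕ} (hN : 0 < N) (x z : Fin N → Fin d)
    (h : empMeasure x = empMeasure z) : ∃ σ : Equiv.Perm (Fin N), z = x ∘ σ := by
  classical
  have hc : ∀ y, Fintype.card {i // z i = y} = Fintype.card {i // x i = y} := by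
    intro y
    have h1 := congrFun h y
    have hN' : (N : ℝ) ≠ 0 := by positivity
    simp only [empMeasure] at h1
    have h2 := mul_left_cancel₀ (by positivity) h1
    rw [Fintype.card_subtype, Fintype.card_subtype]
    simp only [Finset.sum_boole] at h2
    exact_mod_cast h2.symm
  let e : ∀ y, {i // z i = y} ≃ {i // x i = y} := fun y => Fintype.equivOfCardEq (hc y)
  refine ⟨(Equiv.sigmaFiberEquiv z).symm.trans
    ((Equiv.sigmaCongrRight e).trans (Equiv.sigmaFiberEquiv x)), ?_⟩
  funext i
  exact ((e (z i)) ⟨i, rfl⟩).2.symm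

/-- size of the class of `x`. -/
noncomputable def clsCard {d N : ℕ} (x : Fin N → Fin d) : ℝ :=
  classMass (fun _ : Fin N → Fin d => (1 : ℝ)) (empMeasure x)

lemma clsCard_pos {d N : ℕ} (x : Fin N → Fin d) : 0 < clsCard x := by
  classical
  unfold clsCard classMass
  apply Finset.sum_pos
  · intros; norm_num
  · exact ⟨x, by simp⟩

lemma classMass_eq {d N : ℕ} (hN : 0 < N) (Q : (Fin N → Fin d) → ℝ) (hQ : Exchangeable Q)
    (x : Fin N → Fin d) : classMass Q (empMeasure x) = clsCard x * Q x := by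
  unfold clsCard classMass
  rw [Finset.sum_mul]
  apply Finset.sum_congr rfl
  intro z hz
  obtain ⟨σ, rfl⟩ := aux_perm hN x z (Finset.mem_filter.1 hz).2.symm
  rw [hQ σ x, one_mul]

lemma prod_exch {d N : ℕ} (q : Fin d → ℝ) :
    Exchangeable (productMeasure q : (Fin N → Fin d) → ℝ) := by
  intro σ x
  exact Equiv.prod_comp σ (fun i => q (x i))

lemma sum_cons {d N : ℕ} (q : Fin d → ℝ) (F : (Fin (N+1) → Fin d) → ℝ) :
    ∑ x : Fin (N+1) → Fin d, productMeasure q x * F x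
      = ∑ a, q a * ∑ x : Fin N → Fin d, productMeasure q x * F (Fin.cons a x) := by
  rw [← (Fin.consEquiv (fun _ : Fin (N+1) => Fin d)).sum_comp, Fintype.sum_prod_type]
  apply Finset.sum_congr rfl
  intro a _
  rw [Finset.mul_sum]
  apply Finset.sum_congr rfl
  intro x _
  have h : (Fin.consEquiv (fun _ : Fin (N+1) => Fin d)) (a, x) = Fin.cons a x := rfl
  rw [h]
  simp [productMeasure, Fin.prod_univ_succ, mul_assoc]

lemma prod_sum {d : ℕ} (N : ℕ) (q : Fin d → ℝ) (hq : ∑ a, q a = 1) :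
    ∑ x : Fin N → Fin d, productMeasure q x = 1 := by
  induction N with
  | zero => simp [productMeasure]
  | succ N ih =>
    have := sum_cons (N := N) q (fun _ => 1)
    simp only [mul_one, ih] at this
    rw [this, hq]

lemma prod_mean {d : ℕ} (N : ℕ) (q c : Fin d → ℝ) (hq : ∑ a, q a = 1)
    (hc : ∑ a, q a * c a = 0) :
    ∑ x : Fin N → Fin d, productMeasure q x * ∑ i, c (x i) = 0 := by
  induction N with
  | zero => simp
  | succ N ih =>
    rw [sum_cons (N := N) q (fun x => ∑ i, c (x i))]
    simp only [Fin.sum_univ_succ, Fin.cons_zero, Fin.cons_succ, mul_add, Finset.sum_add_distrib, ih,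
      ← Finset.sum_mul, prod_sum N q hq]
    simpa using hc

lemma prod_var {d : ℕ} (N : ℕ) (q c : Fin d → ℝ) (hq : ∑ a, q a = 1)
    (hc : ∑ a, q a * c a = 0) :
    ∑ x : Fin N → Fin d, productMeasure q x * (∑ i, c (x i)) ^ 2 = N * ∑ a, q a * c a ^ 2 := by
  induction N with
  | zero => simp
  | succ N ih =>
    rw [sum_cons (N := N) q (fun x => (∑ i, c (x i)) ^ 2)]
    have key : ∀ a, ∑ x : Fin N → Fin d, productMeasure q x *
        (∑ i, c ((Fin.cons a x : Fin (N+1) → Fin d) i)) ^ 2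
        = c a ^ 2 + N * ∑ a, q a * c a ^ 2 := by
      intro a
      have : ∀ x : Fin N → Fin d, productMeasure q x *
        (∑ i, c ((Fin.cons a x : Fin (N+1) → Fin d) i)) ^ 2 =
        productMeasure q x * c a ^ 2 + 2 * c a * (productMeasure q x * ∑ i, c (x i))
        + productMeasure q x * (∑ i, c (x i)) ^ 2 := by
        intro x
        simp only [Fin.sum_univ_succ, Fin.cons_zero, Fin.cons_succ]
        ring
      simp only [this, Finset.sum_add_distrib, ih, ← Finset.sum_mul, ← Finset.mul_sum,
        prod_sum N q hq, prod_mean N q c hq hc]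
      ring
    simp only [key, mul_add, Finset.sum_add_distrib, ← Finset.sum_mul, hq]
    push_cast
    ring

lemma prod_nonneg' {d N : ℕ} (q : Fin d → ℝ) (hq : q ∈ stdSimplex ℝ (Fin d)) (x : Fin N → Fin d) :
    0 ≤ productMeasure q x := Finset.prod_nonneg fun i _ => hq.1 _

lemma conc {d N : ℕ} (hN : 0 < N) (q : Fin d → ℝ) (hq : q ∈ stdSimplex ℝ (Fin d)) :
    ∑ x : Fin N → Fin d, productMeasure q x * ∑ y, (empMeasure x y - q y) ^ 2 ≤ d / N := by
  have hN' : (N : ℝ) ≠ 0 := by positivity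
  simp only [Finset.mul_sum]
  rw [Finset.sum_comm]
  have : ∀ y : Fin d, ∑ x : Fin N → Fin d, productMeasure q x * (empMeasure x y - q y) ^ 2
      ≤ 1 / N := by
    intro y
    let c : Fin d → ℝ := fun a => (if a = y then 1 else 0) - q y
    have hc : ∑ a, q a * c a = 0 := by
      simp [c, mul_sub, Finset.sum_sub_distrib, ← Finset.sum_mul, hq.2]
    have h := prod_var N q c hq.2 hc
    have h1 : ∀ x : Fin N → Fin d, productMeasure q x * (empMeasure x y - q y) ^ 2
        = (1 / N : ℝ) ^ 2 * (productMeasure q x * (∑ i, c (x i)) ^ 2) := by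
      intro x
      have : empMeasure x y - q y = (1 / N : ℝ) * ∑ i, c (x i) := by
        simp only [empMeasure, c, Finset.sum_sub_distrib, Finset.sum_const, Finset.card_univ,
          Fintype.card_fin, nsmul_eq_mul, mul_sub]
        field_simp
      rw [this]; ring
    simp only [h1, ← Finset.mul_sum, h]
    have h2 : ∑ a, q a * c a ^ 2 ≤ 1 := by
      rw [← hq.2]
      apply Finset.sum_le_sum
      intro a _
      have h0 := hq.1 y
      have h1 : q y ≤ 1 := hq.2 ▸ Finset.single_le_sum (fun i _ => hq.1 i) (Finset.mem_univ y)
      have : c a ^ 2 ≤ 1 := by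
        simp only [c]; split_ifs <;> nlinarith
      nlinarith [hq.1 a]
    calc (1 / N : ℝ) ^ 2 * (N * ∑ a, q a * c a ^ 2) = (1 / N : ℝ) * ∑ a, q a * c a ^ 2 := by
          field_simp
      _ ≤ (1 / N : ℝ) * 1 := by gcongr
      _ = 1 / N := mul_one _
  calc _ ≤ ∑ y : Fin d, (1 / N : ℝ) := Finset.sum_le_sum fun y _ => this y
    _ = d / N := by simp [div_eq_mul_inv]

lemma emp_lattice {d N : ℕ} (hN : 0 < N) (x : Fin N → Fin d) : IsLatticeProb N (empMeasure x) := by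
  have hN' : (N : ℝ) ≠ 0 := by positivity
  refine ⟨⟨fun y => ?_, ?_⟩, fun y => ⟨(Finset.univ.filter fun i => x i = y).card, ?_⟩⟩
  · simp only [empMeasure]
    positivity
  · simp only [empMeasure, ← Finset.mul_sum]
    rw [Finset.sum_comm]
    simp [hN']
  · simp only [empMeasure, Finset.sum_boole]
    field_simp

lemma exists_base {d : ℕ} (q : Fin d → ℝ) (hq : q ∈ stdSimplex ℝ (Fin d)) :
    ∃ a : ℕ → Fin d → ℝ, (∀ N, IsLatticeProb N (a N)) ∧ Tendsto a atTop (nhds q) := by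
  have : ∀ N : ℕ, ∃ r : Fin d → ℝ, IsLatticeProb N r ∧ ∑ y, (r y - q y) ^ 2 ≤ d / N := by
    intro N
    rcases Nat.eq_zero_or_pos N with rfl | hN
    · exact ⟨q, ⟨hq, fun x => ⟨0, by simp⟩⟩, by simp⟩
    · by_contra! hcon
      have h1 := conc hN q hq
      have hs := prod_sum N q hq.2
      have : (d / N : ℝ) < ∑ x : Fin N → Fin d,
          productMeasure q x * ∑ y, (empMeasure x y - q y) ^ 2 := by
        rw [← one_mul (d / N : ℝ), ← hs, Finset.sum_mul]
        apply Finset.sum_lt_sum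
        · intro x _
          exact mul_le_mul_of_nonneg_left (hcon _ (emp_lattice hN x)).le (prod_nonneg' q hq x)
        · obtain ⟨x, hx⟩ : ∃ x : Fin N → Fin d, productMeasure q x ≠ 0 := by
            by_contra! h0
            simp [h0] at hs
          exact ⟨x, Finset.mem_univ _, mul_lt_mul_of_pos_left (hcon _ (emp_lattice hN x))
            (lt_of_le_of_ne (prod_nonneg' q hq x) hx.symm)⟩
      linarith
  choose a ha hb using this
  refine ⟨a, ha, ?_⟩
  rw [tendsto_pi_nhds]
  intro y
  have h0 : Tendsto (fun N : ℕ => (d / N : ℝ)) atTop (nhds 0) :=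
    tendsto_const_div_atTop_nhds_zero_nat _
  have h1 : Tendsto (fun N => (a N y - q y) ^ 2) atTop (nhds 0) :=
    squeeze_zero (fun N => sq_nonneg _) (fun N => (Finset.single_le_sum
      (f := fun y => (a N y - q y) ^ 2) (fun i _ => sq_nonneg _) (Finset.mem_univ y)).trans (hb N)) h0
  have h2 : Tendsto (fun N => |a N y - q y|) atTop (nhds 0) := by
    have := h1.sqrt
    simpa [Real.sqrt_sq_eq_abs] using this
  rw [tendsto_iff_dist_tendsto_zero]
  exact h2

lemma subseq_ldp {d : ℕ} (f : ℕ → (Fin d → ℝ) → ℝ) (q : Fin d → ℝ)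
    (hq : q ∈ stdSimplex ℝ (Fin d)) (l : ℝ)
    (hf : ∀ qseq : (N : ℕ) → Fin d → ℝ,
      (∀ N, IsLatticeProb N (qseq N)) → Tendsto qseq atTop (nhds q) →
      Tendsto (fun N : ℕ => f N (qseq N)) atTop (nhds l))
    (φ : ℕ → ℕ) (hφ : StrictMono φ) (u : ℕ → Fin d → ℝ) (hu : ∀ k, IsLatticeProb (φ k) (u k))
    (hlim : Tendsto u atTop (nhds q)) :
    Tendsto (fun k => f (φ k) (u k)) atTop (nhds l) := by
  classical
  obtain ⟨a, ha, hat⟩ := exists_base q hq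
  let s : ℕ → Fin d → ℝ := fun N => if h : ∃ k, φ k = N then u h.choose else a N
  have hs : ∀ k, s (φ k) = u k := by
    intro k
    have h : ∃ j, φ j = φ k := ⟨k, rfl⟩
    simp only [s, dif_pos h]
    rw [hφ.injective h.choose_spec]
  have hl : ∀ N, IsLatticeProb N (s N) := by
    intro N
    by_cases h : ∃ k, φ k = N
    · obtain ⟨k, rfl⟩ := h
      rw [hs]; exact hu k
    · simp only [s, dif_neg h]; exact ha N
  have ht : Tendsto s atTop (nhds q) := by
    rw [tendsto_def]
    intro U hU
    obtain ⟨n1, h1⟩ := (eventually_atTop.1 (hat.eventually hU))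
    obtain ⟨n2, h2⟩ := (eventually_atTop.1 (hlim.eventually hU))
    refine mem_atTop_sets.2 ⟨max n1 (φ n2), fun N hN => ?_⟩
    show s N ∈ U
    by_cases h : ∃ k, φ k = N
    · obtain ⟨k, rfl⟩ := h
      rw [hs]
      exact h2 k (hφ.le_iff_le.1 ((le_max_right _ _).trans hN))
    · simp only [s, dif_neg h]
      exact h1 N ((le_max_left _ _).trans hN)
  have := (hf s hl ht).comp hφ.tendsto_atTop
  simpa [Function.comp_def, hs] using this

lemma unif {d : ℕ} (f : ℕ → (Fin d → ℝ) → ℝ) (J : (Fin d → ℝ) → ℝ)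
    (hf : ∀ q ∈ stdSimplex ℝ (Fin d), ∀ qseq : (N : ℕ) → Fin d → ℝ,
      (∀ N, IsLatticeProb N (qseq N)) → Tendsto qseq atTop (nhds q) →
      Tendsto (fun N : ℕ => f N (qseq N)) atTop (nhds (- J q)))
    (q : Fin d → ℝ) (ε : ℝ) (hε : 0 < ε) :
    ∃ C : ℕ, ∀ᶠ N in atTop, ∀ r, IsLatticeProb N r →
      |f N r + J q| ≤ ε + C * ∑ y, (r y - q y) ^ 2 := by
  by_contra! hcon
  obtain ⟨φ, hφ, h⟩ := extraction_forall_of_frequently hcon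
  choose u hu hb using h
  obtain ⟨p, hp, ψ, hψ, hlim⟩ := (isCompact_stdSimplex ℝ (Fin d)).tendsto_subseq (fun k => (hu k).1)
  have h1 := subseq_ldp f p hp _ (hf p hp) (φ ∘ ψ) (hφ.comp hψ) (u ∘ ψ) (fun k => hu _) hlim
  have h2 : Tendsto (fun k => |f (φ (ψ k)) (u (ψ k)) + J q|) atTop (nhds |-J p + J q|) :=
    (h1.add_const _).abs
  have h3 : Tendsto (fun k => ∑ y, (u (ψ k) y - q y) ^ 2) atTop (nhds (∑ y, (p y - q y) ^ 2)) := by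
    apply tendsto_finset_sum
    intro y _
    exact (((tendsto_pi_nhds.1 hlim) y).sub_const _).pow 2
  have hpq : p = q := by
    by_contra hne
    have hpos : 0 < ∑ y, (p y - q y) ^ 2 := by
      obtain ⟨y, hy⟩ := Function.ne_iff.1 hne
      exact Finset.sum_pos' (fun i _ => sq_nonneg _) ⟨y, Finset.mem_univ _, by
        have := sub_ne_zero.2 hy
        positivity⟩
    have h4 : Tendsto (fun k => ((ψ k : ℕ) : ℝ) * ∑ y, (u (ψ k) y - q y) ^ 2) atTop atTop :=
      (tendsto_natCast_atTop_atTop.comp hψ.tendsto_atTop).atTop_mul_pos hpos h3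
    have h5 : Tendsto (fun k => |f (φ (ψ k)) (u (ψ k)) + J q|) atTop atTop :=
      tendsto_atTop_mono (fun k => by have := hb (ψ k); linarith) h4
    exact not_tendsto_nhds_of_tendsto_atTop h5 _ h2
  subst hpq
  simp only [neg_add_cancel, abs_zero] at h2
  obtain ⟨k, hk⟩ := (h2.eventually (gt_mem_nhds hε)).exists
  have h6 := hb (ψ k)
  have : 0 ≤ ((ψ k : ℕ) : ℝ) * ∑ y, (u (ψ k) y - p y) ^ 2 := by positivity
  linarith

lemma types_card {d N : ℕ} [DecidableEq (Fin d → ℝ)] :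
    (Finset.univ.image (fun x : Fin N → Fin d => empMeasure x)).card ≤ (N + 1) ^ d := by
  classical
  let g : (Fin d → Fin (N + 1)) → Fin d → ℝ := fun k y => (1 / (N : ℝ)) * ((k y : ℕ) : ℝ)
  have hsub : Finset.univ.image (fun x : Fin N → Fin d => empMeasure x)
      ⊆ Finset.univ.image g := by
    intro r hr
    obtain ⟨x, -, rfl⟩ := Finset.mem_image.1 hr
    refine Finset.mem_image.2 ⟨fun y => ⟨(Finset.univ.filter fun i => x i = y).card, ?_⟩,
      Finset.mem_univ _, ?_⟩
    · have := Finset.card_le_univ (Finset.univ.filter fun i => x i = y)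
      simp only [Fintype.card_fin] at this
      omega
    · funext y
      simp [g, empMeasure]
  calc _ ≤ _ := Finset.card_le_card hsub
    _ ≤ _ := Finset.card_image_le
    _ = _ := by simp

lemma entropy_bound {d N : ℕ} (hN : 0 < N) (q : Fin d → ℝ) (hq : q ∈ stdSimplex ℝ (Fin d)) :
    ∑ x : Fin N → Fin d, productMeasure q x *
      |Real.log (classMass (productMeasure q : (Fin N → Fin d) → ℝ) (empMeasure x))|
      ≤ Real.log (((N + 1) ^ d : ℕ) : ℝ) := by
  classical
  set M : ℝ := (((N + 1) ^ d : ℕ) : ℝ) with hM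
  have hMpos : 0 < M := by rw [hM]; positivity
  let P : (Fin N → Fin d) → ℝ := productMeasure q
  have hP : ∀ x, 0 ≤ P x := prod_nonneg' q hq
  have hs : ∑ x, P x = 1 := prod_sum N q hq.2
  have hcle : ∀ r, classMass P r ≤ 1 := fun r => by
    rw [← hs]
    exact Finset.sum_le_sum_of_subset_of_nonneg (Finset.subset_univ _) (fun i _ _ => hP i)
  have hc0 : ∀ r, 0 ≤ classMass P r := fun r => Finset.sum_nonneg fun i _ => hP i
  have hterm : ∀ x, P x * |Real.log (classMass P (empMeasure x))|
      ≤ P x * (Real.log M - 1) + (1 / M) * (P x / classMass P (empMeasure x)) := by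
    intro x
    rcases (hP x).eq_or_lt with h | h
    · simp [← h]
    · have hc : 0 < classMass P (empMeasure x) := by
        rw [classMass_eq hN P (prod_exch q)]
        exact mul_pos (clsCard_pos x) h
      set c := classMass P (empMeasure x)
      rw [abs_of_nonpos (Real.log_nonpos hc.le (hcle _))]
      have h1 := Real.log_le_sub_one_of_pos (x := 1 / (c * M)) (by positivity)
      rw [Real.log_div one_ne_zero (by positivity), Real.log_mul hc.ne' hMpos.ne', Real.log_one] at h1
      have h2 : -Real.log c ≤ Real.log M - 1 + 1 / (c * M) := by linarith
      calc P x * -Real.log c ≤ P x * (Real.log M - 1 + 1 / (c * M)) := by gcongr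
        _ = _ := by field_simp
  have hfib : ∑ x, P x / classMass P (empMeasure x) ≤ M := by
    rw [← Finset.sum_fiberwise_of_maps_to (s := Finset.univ)
      (t := Finset.univ.image (fun x : Fin N → Fin d => empMeasure x))
      (g := fun x => empMeasure x) (fun x _ => Finset.mem_image_of_mem _ (Finset.mem_univ x))]
    calc _ ≤ ∑ r ∈ Finset.univ.image (fun x : Fin N → Fin d => empMeasure x), (1 : ℝ) := by
          apply Finset.sum_le_sum
          intro r _
          have : ∑ x ∈ Finset.univ.filter (fun x : Fin N → Fin d => empMeasure x = r),
              P x / classMass P (empMeasure x) = classMass P r / classMass P r := by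
            conv_rhs => enter [1]; unfold classMass
            rw [Finset.sum_div]
            apply Finset.sum_congr
            · congr
            · intro x hx
              rw [(Finset.mem_filter.1 hx).2]
          rw [this]
          exact div_self_le_one _
      _ ≤ M := by
          simp only [Finset.sum_const, nsmul_eq_mul, mul_one]
          rw [hM]
          exact Nat.cast_le.2 types_card
  calc _ ≤ ∑ x, (P x * (Real.log M - 1) + (1 / M) * (P x / classMass P (empMeasure x))) :=
        Finset.sum_le_sum fun x _ => hterm x
    _ = (Real.log M - 1) + (1 / M) * ∑ x, P x / classMass P (empMeasure x) := by
        rw [Finset.sum_add_distrib, ← Finset.sum_mul, hs, Finset.mul_sum, one_mul]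
    _ ≤ (Real.log M - 1) + (1 / M) * M := by gcongr
    _ = _ := by field_simp; ring

lemma main_bound {d N : ℕ} (hN : 0 < N) (q : Fin d → ℝ) (hq : q ∈ stdSimplex ℝ (Fin d))
    (Q : (Fin N → Fin d) → ℝ) (hQ : Exchangeable Q) (j ε : ℝ) (C : ℕ)
    (hb : ∀ r, IsLatticeProb N r →
      |(1 / (N : ℝ)) * Real.log (classMass Q r) + j| ≤ ε + C * ∑ y, (r y - q y) ^ 2) :
    |(1 / (N : ℝ)) * relEntN (productMeasure q) Q - j|
      ≤ ε + C * (d / N) + (1 / N) * Real.log (((N + 1) ^ d : ℕ) : ℝ) := by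
  let P : (Fin N → Fin d) → ℝ := productMeasure q
  have hP : ∀ x, 0 ≤ P x := prod_nonneg' q hq
  have hs : ∑ x, P x = 1 := prod_sum N q hq.2
  have hterm : ∀ x, |(1 / (N : ℝ)) * (P x * Real.log (P x / Q x)) - P x * j|
      ≤ (1 / N) * (P x * |Real.log (classMass P (empMeasure x))|)
        + (P x * ε + C * (P x * ∑ y, (empMeasure x y - q y) ^ 2)) := by
    intro x
    have h1 := hb _ (emp_lattice hN x)
    have h2 : |(1 / (N : ℝ)) * Real.log (P x / Q x) - j| * P x ≤
        ((1 / N) * |Real.log (classMass P (empMeasure x))|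
          + |(1 / (N : ℝ)) * Real.log (classMass Q (empMeasure x)) + j|) * P x := by
      rcases (hP x).eq_or_lt with h | h
      · simp [← h]
      · refine mul_le_mul_of_nonneg_right ?_ h.le
        by_cases hQ0 : Q x = 0
        · have : classMass Q (empMeasure x) = 0 := by rw [classMass_eq hN Q hQ, hQ0, mul_zero]
          rw [this, hQ0]
          simp only [div_zero, Real.log_zero, mul_zero, zero_sub, zero_add, abs_neg]
          have : 0 ≤ (1 / (N : ℝ)) * |Real.log (classMass P (empMeasure x))| := by positivity
          linarith
        · have hn := (clsCard_pos x).ne'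
          have : Real.log (P x / Q x) = Real.log (classMass P (empMeasure x))
              - Real.log (classMass Q (empMeasure x)) := by
            rw [classMass_eq hN Q hQ, classMass_eq hN P (prod_exch q),
              Real.log_mul hn h.ne', Real.log_mul hn hQ0, Real.log_div h.ne' hQ0]
            ring
          rw [this]
          have e : (1 / (N : ℝ)) * (Real.log (classMass P (empMeasure x))
              - Real.log (classMass Q (empMeasure x))) - j
              = (1 / (N : ℝ)) * Real.log (classMass P (empMeasure x))
                - ((1 / (N : ℝ)) * Real.log (classMass Q (empMeasure x)) + j) := by ring
          rw [e]
          refine (abs_sub _ _).trans ?_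
          rw [abs_mul, abs_of_nonneg (show (0 : ℝ) ≤ 1 / N by positivity)]
    have h3 : |(1 / (N : ℝ)) * (P x * Real.log (P x / Q x)) - P x * j|
        = |(1 / (N : ℝ)) * Real.log (P x / Q x) - j| * P x := by
      rw [← abs_of_nonneg (hP x), ← abs_mul, abs_of_nonneg (hP x)]
      congr 1; ring
    rw [h3]
    refine h2.trans ?_
    nlinarith [mul_le_mul_of_nonneg_right h1 (hP x)]
  have e : (1 / (N : ℝ)) * relEntN (productMeasure q) Q - j
      = ∑ x, ((1 / (N : ℝ)) * (P x * Real.log (P x / Q x)) - P x * j) := by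
    rw [Finset.sum_sub_distrib, ← Finset.sum_mul, hs, ← Finset.mul_sum, one_mul]
    rfl
  rw [e]
  refine (Finset.abs_sum_le_sum_abs _ _).trans ((Finset.sum_le_sum fun x _ => hterm x).trans ?_)
  rw [Finset.sum_add_distrib, Finset.sum_add_distrib, ← Finset.sum_mul, hs, ← Finset.mul_sum,
    ← Finset.mul_sum, one_mul]
  have h1 := entropy_bound hN q hq
  have h2 := conc hN q hq
  have h3 := mul_le_mul_of_nonneg_left h1 (show (0 : ℝ) ≤ 1 / N by positivity)
  have h4 := mul_le_mul_of_nonneg_left h2 (show (0 : ℝ) ≤ C by positivity)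
  linarith

lemma log_lim (d : ℕ) :
    Tendsto (fun N : ℕ => (1 / (N : ℝ)) * Real.log (((N + 1) ^ d : ℕ) : ℝ)) atTop (nhds 0) := by
  have h := (Real.tendsto_pow_log_div_mul_add_atTop 1 (-1) 1 one_ne_zero).comp
    (tendsto_natCast_atTop_atTop.comp (tendsto_add_atTop_nat 1))
  have h2 := h.const_mul (d : ℝ)
  rw [mul_zero] at h2
  refine h2.congr fun N => ?_
  simp [Function.comp_def]
  ring

/-- If the exchangeable probability measures `Q^N` on `𝒳^N` satisfy a locally
uniform LDP for the empirical measure with a rate function `J` that is lower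
semicontinuous, nonnegative and finite on `𝒫(𝒳)`, then for every
`q ∈ 𝒫(𝒳)`, `(1/N) R(⊗^N q ‖ Q^N) → J(q)` as `N → ∞`. -/
theorem scaled_relative_entropy_limit
    (d : ℕ) (hd : 2 ≤ d)
    (Q : ∀ N : ℕ, (Fin N → Fin d) → ℝ)
    (hQpos : ∀ N, ∀ y : Fin N → Fin d, 0 ≤ Q N y)
    (hQsum : ∀ N, ∑ y : Fin N → Fin d, Q N y = 1)
    (hQexch : ∀ N, Exchangeable (Q N))
    (J : (Fin d → ℝ) → ℝ)
    (hJnonneg : ∀ q ∈ stdSimplex ℝ (Fin d), 0 ≤ J q)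
    (hJlsc : LowerSemicontinuousOn J (stdSimplex ℝ (Fin d)))
    (hLDP : LocallyUniformLDP Q J) :
    ∀ q ∈ stdSimplex ℝ (Fin d),
      Tendsto (fun N : ℕ => (1 / (N : ℝ)) * relEntN (productMeasure q) (Q N))
        atTop (nhds (J q)) := by
  intro q hq
  rw [Metric.tendsto_atTop']
  intro ε hε
  obtain ⟨C, hC⟩ := unif (fun N r => (1 / (N : ℝ)) * Real.log (classMass (Q N) r)) J
    (fun q hq s hs ht => hLDP q hq s hs ht) q (ε / 2) (half_pos hε)
  have hlim : Tendsto (fun N : ℕ => ε / 2 + C * (d / N : ℝ)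
      + (1 / (N : ℝ)) * Real.log (((N + 1) ^ d : ℕ) : ℝ)) atTop (nhds (ε / 2 + C * 0 + 0)) :=
    (((tendsto_const_div_atTop_nhds_zero_nat _).const_mul _).const_add _).add (log_lim d)
  have hlt := hlim.eventually (gt_mem_nhds (show ε / 2 + C * 0 + 0 < ε by linarith))
  obtain ⟨n, hn⟩ := eventually_atTop.1 ((hC.and hlt).and (eventually_gt_atTop 0))
  refine ⟨n, fun N hN => ?_⟩
  obtain ⟨⟨h1, h2⟩, h3⟩ := hn N hN.le
  rw [Real.dist_eq]
  exact (main_bound h3 q hq (Q N) (hQexch N) (J q) (ε / 2) C h1).trans_lt h2
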